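/- arXiv:2301.13731 — 8 statements merged into one kernel-verified Lean document; each statement's English description precedes it below -/
import Mathlib

section
/- Let n ≥ 1, let f : ℝⁿ → ℝ be differentiable with L_f-Lipschitz gradient and bounded below, let M > 0 and let φ : ℝⁿ → ℝ be M-weakly convex and bounded below. Let λ > 0 and let τ > 0 satisfy τ < 2/(λ·L_f + M). Let (x_k) be a PGD sequence for f, φ, λ, τ. Then the sequence of values F(x_k), where F := λ·f + φ, is monotonically non-increasing and converges to a finite limit. -/
open Filter Topology

/-- The descent lemma: a function with `L`-Lipschitz gradient lies below its quadratic upper model. -/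
theorem le_quadratic_model_of_lipschitz_gradient {E : Type*} [NormedAddCommGroup E]
    [InnerProductSpace ℝ E] [CompleteSpace E] {f : E → ℝ} {L : ℝ} (hf : Differentiable ℝ f)
    (hLip : ∀ a b, ‖gradient f a - gradient f b‖ ≤ L * ‖a - b‖) (a u : E) :
    f (a + u) ≤ f a + inner ℝ (gradient f a) u + L / 2 * ‖u‖ ^ 2 := by
  have hder : ∀ t : ℝ, HasDerivAt
      (fun t : ℝ => f (a + t • u) - t * inner ℝ (gradient f a) u - L / 2 * ‖u‖ ^ 2 * t ^ 2)
      (inner ℝ (gradient f (a + t • u)) u - inner ℝ (gradient f a) u - L * ‖u‖ ^ 2 * t) t := by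
    intro t
    have h1 : HasDerivAt (fun t : ℝ => a + t • u) u t := by
      simpa using ((hasDerivAt_id t).smul_const u).const_add a
    have h2 : HasDerivAt (fun t : ℝ => f (a + t • u)) (inner ℝ (gradient f (a + t • u)) u) t := by
      simpa [Function.comp_def] using
        (hf (a + t • u)).hasGradientAt.hasFDerivAt.comp_hasDerivAt t h1
    have h3 := (hasDerivAt_id t).mul_const (inner ℝ (gradient f a) u)
    have h4 := ((hasDerivAt_id t).pow 2).const_mul (L / 2 * ‖u‖ ^ 2)
    refine ((h2.sub h3).sub h4).congr_deriv ?_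
    simp only [id_eq]
    ring
  have hanti : AntitoneOn
      (fun t : ℝ => f (a + t • u) - t * inner ℝ (gradient f a) u - L / 2 * ‖u‖ ^ 2 * t ^ 2)
      (Set.Icc 0 1) := by
    refine antitoneOn_of_deriv_nonpos (convex_Icc 0 1)
      (fun t _ => (hder t).continuousAt.continuousWithinAt)
      (fun t _ => (hder t).differentiableAt.differentiableWithinAt) fun t ht => ?_
    rw [interior_Icc] at ht
    rw [(hder t).deriv, ← inner_sub_left]
    have h1 := real_inner_le_norm (gradient f (a + t • u) - gradient f a) u
    have h2 := hLip (a + t • u) a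
    rw [add_sub_cancel_left, norm_smul, Real.norm_of_nonneg ht.1.le] at h2
    nlinarith [mul_le_mul_of_nonneg_right h2 (norm_nonneg u)]
  have h := hanti (Set.left_mem_Icc.2 zero_le_one) (Set.right_mem_Icc.2 zero_le_one) zero_le_one
  simp only [one_smul, zero_smul, add_zero] at h
  linarith

/-- A number `A` with `0 ≤ A + t * B` for all `t ∈ (0, 1]` is nonnegative. -/
theorem nonneg_of_forall_nonneg_add_mul {A B : ℝ}
    (h : ∀ t : ℝ, 0 < t → t ≤ 1 → 0 ≤ A + t * B) : 0 ≤ A := by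
  have hlim : Tendsto (fun t : ℝ => A + t * B) (𝓝[>] 0) (𝓝 A) := by
    have : ContinuousWithinAt (fun t : ℝ => A + t * B) (Set.Ioi 0) 0 := by fun_prop
    simpa [ContinuousWithinAt] using this
  refine ge_of_tendsto hlim ?_
  filter_upwards [Ioc_mem_nhdsGT (zero_lt_one' ℝ)] with t ht using h t ht.1 ht.2

/-- First-order comparison between a minimizer `b` of the proximal objective of a weakly convex
function, centred at `a - s • g`, and the point `a`. -/
theorem prox_minimizer_le {E : Type*} [NormedAddCommGroup E] [InnerProductSpace ℝ E]
    {φ : E → ℝ} {M τ s : ℝ} (hτ : 0 < τ)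
    (hφ : ConvexOn ℝ Set.univ (fun w => φ w + (M / 2) * ‖w‖ ^ 2)) {a b g : E}
    (hb : IsMinOn (fun w => τ * φ w + (1 / 2) * ‖w - (a - s • g)‖ ^ 2) Set.univ b) :
    τ * φ b + s * inner ℝ g (b - a) + (1 - τ * M / 2) * ‖b - a‖ ^ 2 ≤ τ * φ a := by
  suffices h : 0 ≤ τ * φ a - (τ * φ b + s * inner ℝ g (b - a) +
      (1 - τ * M / 2) * ‖b - a‖ ^ 2) by linarith
  refine nonneg_of_forall_nonneg_add_mul (B := (1 - τ * M) / 2 * ‖b - a‖ ^ 2) fun t ht ht1 => ?_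
  have hmin := isMinOn_univ_iff.1 hb ((1 - t) • b + t • a)
  have hconv := hφ.2 (Set.mem_univ b) (Set.mem_univ a) (sub_nonneg.2 ht1) ht.le (by ring)
  simp only [smul_eq_mul] at hconv
  have e1 : ‖(1 - t) • b + t • a‖ ^ 2 =
      (1 - t) * ‖b‖ ^ 2 + t * ‖a‖ ^ 2 - t * (1 - t) * ‖b - a‖ ^ 2 := by
    rw [norm_add_sq_real, norm_sub_sq_real, norm_smul, norm_smul, mul_pow, mul_pow,
      Real.norm_eq_abs, Real.norm_eq_abs, sq_abs, sq_abs, real_inner_smul_left,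
      real_inner_smul_right]
    ring
  have e2 : ‖(1 - t) • b + t • a - (a - s • g)‖ ^ 2 = (1 - t) ^ 2 * ‖b - a‖ ^ 2 +
      2 * (1 - t) * s * inner ℝ g (b - a) + ‖s • g‖ ^ 2 := by
    have : (1 - t) • b + t • a - (a - s • g) = (1 - t) • (b - a) + s • g := by module
    rw [this, norm_add_sq_real, norm_smul, mul_pow, Real.norm_eq_abs, sq_abs,
      real_inner_smul_left, real_inner_smul_right, real_inner_comm]
    ring
  have e3 : ‖b - (a - s • g)‖ ^ 2 = ‖b - a‖ ^ 2 +
      2 * s * inner ℝ g (b - a) + ‖s • g‖ ^ 2 := by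
    have : b - (a - s • g) = (b - a) + s • g := by module
    rw [this, norm_add_sq_real, real_inner_smul_right, real_inner_comm]
    ring
  rw [e1] at hconv
  rw [e2, e3] at hmin
  have hτconv := mul_le_mul_of_nonneg_left hconv hτ.le
  refine nonneg_of_mul_nonneg_right (a := t) ?_ ht
  nlinarith

/-- Monotone decrease and convergence of the objective values along a PGD
sequence, for `f` with `L_f`-Lipschitz gradient and `φ` `M`-weakly convex,
for stepsize `τ < 2/(λ L_f + M)`. -/
theorem pgd_values_antitone_and_converge
    (n : ℕ) (hn : 1 ≤ n)
    (f φ : EuclideanSpace ℝ (Fin n) → ℝ) (Lf M lam τ : ℝ)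
    (hf : Differentiable ℝ f)
    (hLip : ∀ a b, ‖gradient f a - gradient f b‖ ≤ Lf * ‖a - b‖)
    (hfb : BddBelow (Set.range f))
    (hM : 0 < M)
    (hφ : ConvexOn ℝ Set.univ (fun w => φ w + (M / 2) * ‖w‖ ^ 2))
    (hφb : BddBelow (Set.range φ))
    (hlam : 0 < lam) (hτ : 0 < τ) (hτlt : τ < 2 / (lam * Lf + M))
    (x : ℕ → EuclideanSpace ℝ (Fin n))
    (hx : ∀ k, IsMinOn
      (fun w => τ * φ w + (1 / 2) * ‖w - (x k - (τ * lam) • gradient f (x k))‖ ^ 2)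
      Set.univ (x (k + 1))) :
    Antitone (fun k : ℕ => lam * f (x k) + φ (x k)) ∧
    ∃ l : ℝ, Tendsto (fun k : ℕ => lam * f (x k) + φ (x k)) atTop (nhds l) := by
  have : Nonempty (Fin n) := ⟨⟨0, hn⟩⟩
  have hLf : 0 ≤ Lf := by
    obtain ⟨v, hv⟩ := exists_ne (0 : EuclideanSpace ℝ (Fin n))
    have h := (norm_nonneg _).trans (hLip v 0)
    rw [sub_zero] at h
    exact nonneg_of_mul_nonneg_left h (norm_pos_iff.2 hv)
  have hstep : τ * (lam * Lf + M) < 2 := (lt_div_iff₀ (by positivity)).1 hτlt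
  have hanti : Antitone (fun k : ℕ => lam * f (x k) + φ (x k)) := by
    refine antitone_nat_of_succ_le fun k => ?_
    have h1 := le_quadratic_model_of_lipschitz_gradient hf hLip (x k) (x (k + 1) - x k)
    rw [add_sub_cancel] at h1
    have h2 := prox_minimizer_le hτ hφ (hx k)
    have h3 := mul_le_mul_of_nonneg_left h1 (mul_pos hτ hlam).le
    have h4 := mul_nonneg (sub_pos.2 hstep).le (sq_nonneg ‖x (k + 1) - x k‖)
    refine le_of_mul_le_mul_left ?_ hτ
    linarith
  refine ⟨hanti, _, tendsto_atTop_ciInf hanti ?_⟩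
  obtain ⟨c, hc⟩ := hfb
  obtain ⟨d, hd⟩ := hφb
  refine ⟨lam * c + d, ?_⟩
  rintro _ ⟨k, rfl⟩
  exact add_le_add (mul_le_mul_of_nonneg_left (hc ⟨_, rfl⟩) hlam.le) (hd ⟨_, rfl⟩)
end

section
/- Let n ≥ 1, let f : ℝⁿ → ℝ be differentiable with L_f-Lipschitz gradient, let M > 0 and let φ : ℝⁿ → ℝ be M-weakly convex. Let λ > 0, τ > 0, let x ∈ ℝⁿ and let x⁺ be a global minimizer over ℝⁿ of w ↦ τ·φ(w) + (1/2)‖w − (x − τ·λ·∇f(x))‖². Then, with F := λ·f + φ, one has F(x) ≥ F(x⁺) + (1/τ − (M + λ·L_f)/2)·‖x − x⁺‖². -/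
open scoped InnerProductSpace

section

variable {E : Type*} [NormedAddCommGroup E] [InnerProductSpace ℝ E]

/-- The descent lemma for a function with Lipschitz gradient. -/
theorem le_add_inner_gradient_add_sq_of_lipschitz_gradient [CompleteSpace E]
    {f : E → ℝ} {L : ℝ} (hf : Differentiable ℝ f)
    (hL : ∀ a b, ‖gradient f a - gradient f b‖ ≤ L * ‖a - b‖) (x v : E) :
    f (x + v) ≤ f x + ⟪gradient f x, v⟫_ℝ + L / 2 * ‖v‖ ^ 2 := by
  have hderiv (t : ℝ) : HasDerivAt
      (fun s : ℝ => f (x + s • v) - s * ⟪gradient f x, v⟫_ℝ - L / 2 * ‖v‖ ^ 2 * s ^ 2)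
      (⟪gradient f (x + t • v), v⟫_ℝ - ⟪gradient f x, v⟫_ℝ - L * ‖v‖ ^ 2 * t) t := by
    have hline : HasDerivAt (fun s : ℝ => x + s • v) v t := by
      simpa using ((hasDerivAt_id t).smul_const v).const_add x
    have hcomp := (hf (x + t • v)).hasGradientAt.hasFDerivAt.comp_hasDerivAt t hline
    rw [InnerProductSpace.toDual_apply_apply] at hcomp
    refine ((hcomp.sub ((hasDerivAt_id t).mul_const _)).sub
      ((hasDerivAt_pow 2 t).const_mul (L / 2 * ‖v‖ ^ 2))).congr_deriv ?_
    norm_num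
    ring
  have hanti := antitoneOn_of_deriv_nonpos (convex_Icc (0 : ℝ) 1)
    (fun t _ => (hderiv t).continuousAt.continuousWithinAt)
    (fun t _ => (hderiv t).differentiableAt.differentiableWithinAt) (fun t ht => by
      rw [interior_Icc] at ht
      rw [(hderiv t).deriv, ← inner_sub_left]
      have hgrad := hL (x + t • v) x
      rw [add_sub_cancel_left, norm_smul, Real.norm_of_nonneg ht.1.le] at hgrad
      have hinner := (real_inner_le_norm _ v).trans
        (mul_le_mul_of_nonneg_right hgrad (norm_nonneg v))
      linarith)
  have h01 := hanti (Set.left_mem_Icc.2 zero_le_one) (Set.right_mem_Icc.2 zero_le_one) zero_le_one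
  simp only [one_smul, zero_smul, add_zero] at h01
  linarith

/-- The quadratic upper bound along segments for a weakly convex function. -/
theorem ConvexOn.map_add_smul_sub_le_of_add_sq {φ : E → ℝ} {M : ℝ}
    (hφ : ConvexOn ℝ Set.univ (fun w => φ w + M / 2 * ‖w‖ ^ 2)) (a b : E) {t : ℝ}
    (ht0 : 0 ≤ t) (ht1 : t ≤ 1) :
    φ (a + t • (b - a)) ≤
      (1 - t) * φ a + t * φ b + M / 2 * (t * (1 - t)) * ‖b - a‖ ^ 2 := by
  have hconv := hφ.2 (Set.mem_univ a) (Set.mem_univ b) (sub_nonneg.2 ht1) ht0 (by ring)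
  have hcomb : (1 - t) • a + t • b = a + t • (b - a) := by module
  have hsq : ‖b‖ ^ 2 = ‖a‖ ^ 2 + 2 * ⟪a, b - a⟫_ℝ + ‖b - a‖ ^ 2 := by
    simpa using norm_add_sq_real a (b - a)
  have hsqt := norm_add_sq_real a (t • (b - a))
  rw [real_inner_smul_right, norm_smul, mul_pow, Real.norm_eq_abs, sq_abs] at hsqt
  simp only [smul_eq_mul, hcomb, hsqt, hsq] at hconv
  linarith

/-- The first-order inequality at a minimizer of a proximal objective. -/
theorem IsMinOn.proximal_inequality_of_weaklyConvex {φ : E → ℝ} {M τ : ℝ}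
    (hφ : ConvexOn ℝ Set.univ (fun w => φ w + M / 2 * ‖w‖ ^ 2)) (hτ : 0 ≤ τ) {y p : E}
    (hp : IsMinOn (fun w => τ * φ w + 1 / 2 * ‖w - y‖ ^ 2) Set.univ p) (x : E) :
    0 ≤ τ * (φ x - φ p) + τ * (M / 2) * ‖x - p‖ ^ 2 + ⟪p - y, x - p⟫_ℝ := by
  have hsegment (t : ℝ) (ht : t ∈ Set.Ioo (0 : ℝ) 1) :
      0 ≤ τ * (φ x - φ p) + τ * (M / 2) * (1 - t) * ‖x - p‖ ^ 2 + ⟪p - y, x - p⟫_ℝ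
        + t / 2 * ‖x - p‖ ^ 2 := by
    have hmin := isMinOn_univ_iff.1 hp (p + t • (x - p))
    have hweak := mul_le_mul_of_nonneg_left
      (hφ.map_add_smul_sub_le_of_add_sq p x ht.1.le ht.2.le) hτ
    have hsq := norm_add_sq_real (p - y) (t • (x - p))
    rw [real_inner_smul_right, norm_smul, mul_pow, Real.norm_eq_abs, sq_abs] at hsq
    rw [add_sub_right_comm, hsq] at hmin
    refine nonneg_of_mul_nonneg_right (a := t) ?_ ht.1
    linarith
  have hcont : Continuous (fun t : ℝ =>
      τ * (φ x - φ p) + τ * (M / 2) * (1 - t) * ‖x - p‖ ^ 2 + ⟪p - y, x - p⟫_ℝ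
        + t / 2 * ‖x - p‖ ^ 2) := by fun_prop
  have hlim := ge_of_tendsto ((hcont.tendsto 0).mono_left nhdsWithin_le_nhds)
    (Filter.eventually_of_mem (Ioo_mem_nhdsGT zero_lt_one) hsegment)
  simpa using hlim

end


/-- One-step sufficient decrease inequality for the proximal gradient step,
with `f` having `L_f`-Lipschitz gradient and `φ` `M`-weakly convex. -/
theorem pgd_one_step_decrease
    (n : ℕ) (hn : 1 ≤ n)
    (f φ : EuclideanSpace ℝ (Fin n) → ℝ) (Lf M lam τ : ℝ)
    (hf : Differentiable ℝ f)
    (hLip : ∀ a b, ‖gradient f a - gradient f b‖ ≤ Lf * ‖a - b‖)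
    (hM : 0 < M)
    (hφ : ConvexOn ℝ Set.univ (fun w => φ w + (M / 2) * ‖w‖ ^ 2))
    (hlam : 0 < lam) (hτ : 0 < τ)
    (x xp : EuclideanSpace ℝ (Fin n))
    (hxp : IsMinOn
      (fun w => τ * φ w + (1 / 2) * ‖w - (x - (τ * lam) • gradient f x)‖ ^ 2)
      Set.univ xp) :
    lam * f x + φ x ≥
      lam * f xp + φ xp + (1 / τ - (M + lam * Lf) / 2) * ‖x - xp‖ ^ 2 := by
  have hprox := hxp.proximal_inequality_of_weaklyConvex hφ hτ.le x
  have hdescent := mul_le_mul_of_nonneg_left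
    (le_add_inner_gradient_add_sq_of_lipschitz_gradient hf hLip x (xp - x)) hlam.le
  have hres : xp - (x - (τ * lam) • gradient f x) =
      (τ * lam) • gradient f x - (x - xp) := by abel
  rw [hres, inner_sub_left, real_inner_smul_left, real_inner_self_eq_norm_sq] at hprox
  rw [add_sub_cancel, ← neg_sub x xp, inner_neg_right, norm_neg] at hdescent
  have hdiv : 0 ≤ φ x - φ xp + M / 2 * ‖x - xp‖ ^ 2 + lam * ⟪gradient f x, x - xp⟫_ℝ
      - 1 / τ * ‖x - xp‖ ^ 2 := by
    refine nonneg_of_mul_nonneg_right (a := τ) ?_ hτ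
    have hcancel : τ * (1 / τ * ‖x - xp‖ ^ 2) = ‖x - xp‖ ^ 2 := by field_simp
    linarith
  linarith
end

section
/- Let n ≥ 1, let f : ℝⁿ → ℝ be differentiable with L_f-Lipschitz gradient, let M > 0 and let φ : ℝⁿ → ℝ be M-weakly convex. Let λ > 0 and τ > 0 satisfy τ < 2/(λ·L_f + M), let F := λ·f + φ and let F* ∈ ℝ be a lower bound of F. Let (x_k) be a PGD sequence for f, φ, λ, τ. Then: (a) for every K ≥ 1, the sum over k = 0, …, K−1 of ‖x_{k+1} − x_k‖² is at most (F(x_0) − F*)/(1/τ − (M + λ·L_f)/2); (b) for every K ≥ 1 the minimum over 0 ≤ k < K of ‖x_{k+1} − x_k‖² is at most (F(x_0) − F*)/(K·(1/τ − (M + λ·L_f)/2)); (c) ‖x_{k+1} − x_k‖ tends to 0 as k → ∞. -/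
open Filter Topology

section Descent

variable {E : Type*} [NormedAddCommGroup E] [InnerProductSpace ℝ E]

/-- The descent lemma for a function with Lipschitz gradient. -/
theorem le_add_inner_gradient_add_sq [CompleteSpace E] {f : E → ℝ} {L : ℝ}
    (hf : Differentiable ℝ f)
    (hLip : ∀ a b, ‖gradient f a - gradient f b‖ ≤ L * ‖a - b‖) (x v : E) :
    f (x + v) ≤ f x + inner ℝ (gradient f x) v + L / 2 * ‖v‖ ^ 2 := by
  have hd : ∀ t : ℝ, HasDerivAt
      (fun t : ℝ => f (x + t • v) - t * inner ℝ (gradient f x) v - L / 2 * ‖v‖ ^ 2 * t ^ 2)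
      (inner ℝ (gradient f (x + t • v)) v - inner ℝ (gradient f x) v - L * ‖v‖ ^ 2 * t) t := by
    intro t
    have hline : HasDerivAt (fun t : ℝ => x + t • v) v t := by
      simpa using ((hasDerivAt_id t).smul_const v).const_add x
    have hcomp := (hf (x + t • v)).hasGradientAt.hasFDerivAt.comp_hasDerivAt t hline
    rw [InnerProductSpace.toDual_apply_apply] at hcomp
    refine ((hcomp.sub ((hasDerivAt_id t).mul_const (inner ℝ (gradient f x) v))).sub
      ((hasDerivAt_pow 2 t).const_mul (L / 2 * ‖v‖ ^ 2))).congr_deriv ?_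
    push_cast
    ring
  have hanti := antitoneOn_of_deriv_nonpos (convex_Icc (0 : ℝ) 1)
    (fun t _ => (hd t).continuousAt.continuousWithinAt)
    (fun t _ => (hd t).differentiableAt.differentiableWithinAt) (by
      intro t ht
      rw [interior_Icc] at ht
      rw [(hd t).deriv, ← inner_sub_left]
      have h1 := real_inner_le_norm (gradient f (x + t • v) - gradient f x) v
      have h2 := hLip (x + t • v) x
      rw [add_sub_cancel_left, norm_smul, Real.norm_of_nonneg ht.1.le] at h2
      nlinarith [mul_le_mul_of_nonneg_right h2 (norm_nonneg v)])
  have h := hanti (Set.left_mem_Icc.2 zero_le_one) (Set.right_mem_Icc.2 zero_le_one) zero_le_one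
  simp only [one_smul, zero_smul, add_zero] at h
  linarith

/-- A weakly convex function along a segment. -/
theorem weaklyConvex_segment_le {φ : E → ℝ} {M : ℝ}
    (hφ : ConvexOn ℝ Set.univ (fun w => φ w + (M / 2) * ‖w‖ ^ 2)) (u d : E) {t : ℝ}
    (ht0 : 0 ≤ t) (ht1 : t ≤ 1) :
    φ (u + t • d) ≤ (1 - t) * φ u + t * φ (u + d) + M / 2 * (t * (1 - t)) * ‖d‖ ^ 2 := by
  have h := hφ.2 (Set.mem_univ u) (Set.mem_univ (u + d)) (sub_nonneg.2 ht1) ht0 (by ring)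
  have hw : (1 - t) • u + t • (u + d) = u + t • d := by module
  simp only [hw, smul_eq_mul] at h
  rw [norm_add_sq_real, norm_add_sq_real, inner_smul_right, norm_smul, mul_pow,
    Real.norm_eq_abs, sq_abs] at h
  linarith

/-- The proximal inequality for a minimizer of a weakly convex function plus a quadratic. -/
theorem prox_le_of_weaklyConvex {φ : E → ℝ} {M τ : ℝ}
    (hτ : 0 < τ) (hφ : ConvexOn ℝ Set.univ (fun w => φ w + (M / 2) * ‖w‖ ^ 2)) {x u g : E}
    (hu : IsMinOn (fun w => τ * φ w + (1 / 2) * ‖w - (x - g)‖ ^ 2) Set.univ u) :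
    τ * φ u ≤ τ * φ x + (τ * M / 2 - 1) * ‖x - u‖ ^ 2 + inner ℝ g (x - u) := by
  obtain ⟨d, rfl⟩ : ∃ d, x = u + d := ⟨x - u, by abel⟩
  rw [add_sub_cancel_left]
  have key : ∀ t ∈ Set.Ioc (0 : ℝ) 1, τ * φ u ≤ τ * φ (u + d)
      + (τ * M / 2 * (1 - t) - 1 + t / 2) * ‖d‖ ^ 2 + inner ℝ g d := by
    intro t ht
    have h1 := isMinOn_iff.1 hu (u + t • d) (Set.mem_univ _)
    have h2 := mul_le_mul_of_nonneg_left (weaklyConvex_segment_le hφ u d ht.1.le ht.2) hτ.le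
    have e1 : u - (u + d - g) = g - d := by abel
    have e2 : u + t • d - (u + d - g) = (g - d) + t • d := by abel
    simp only [e1, e2] at h1
    rw [norm_add_sq_real (g - d), inner_smul_right, inner_sub_left,
      real_inner_self_eq_norm_sq, norm_smul, mul_pow, Real.norm_eq_abs, sq_abs] at h1
    refine le_of_mul_le_mul_left ?_ ht.1
    linarith
  have hlim : Tendsto (fun t : ℝ => τ * φ (u + d)
      + (τ * M / 2 * (1 - t) - 1 + t / 2) * ‖d‖ ^ 2 + inner ℝ g d) (𝓝[>] 0)
      (𝓝 (τ * φ (u + d) + (τ * M / 2 - 1) * ‖d‖ ^ 2 + inner ℝ g d)) := by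
    refine Tendsto.mono_left ?_ nhdsWithin_le_nhds
    refine Continuous.tendsto' (by fun_prop) _ _ (by ring)
  exact ge_of_tendsto hlim (eventually_of_mem (Ioc_mem_nhdsGT zero_lt_one) key)

/-- Sufficient decrease of one proximal gradient step. -/
theorem proximal_gradient_step_decrease [CompleteSpace E] {f φ : E → ℝ} {L M lam τ : ℝ}
    (hf : Differentiable ℝ f)
    (hLip : ∀ a b, ‖gradient f a - gradient f b‖ ≤ L * ‖a - b‖)
    (hφ : ConvexOn ℝ Set.univ (fun w => φ w + (M / 2) * ‖w‖ ^ 2))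
    (hlam : 0 ≤ lam) (hτ : 0 < τ) {x u : E}
    (hu : IsMinOn (fun w => τ * φ w + (1 / 2) * ‖w - (x - (τ * lam) • gradient f x)‖ ^ 2)
      Set.univ u) :
    (1 / τ - (M + lam * L) / 2) * ‖u - x‖ ^ 2 ≤ (lam * f x + φ x) - (lam * f u + φ u) := by
  have h1 := prox_le_of_weaklyConvex hτ hφ hu
  have h2 := mul_le_mul_of_nonneg_left (le_add_inner_gradient_add_sq hf hLip x (u - x)) hlam
  rw [add_sub_cancel] at h2
  rw [inner_smul_left, ← neg_sub u x, inner_neg_right, norm_neg] at h1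
  simp only [conj_trivial] at h1
  have h3 : φ u ≤ φ x + (M / 2 - 1 / τ) * ‖u - x‖ ^ 2
      - lam * inner ℝ (gradient f x) (u - x) := by
    refine le_of_mul_le_mul_left (h1.trans_eq ?_) hτ
    field_simp
    ring
  linarith

end Descent

/-- Summability of squared residuals, `O(1/K)` rate for the minimal squared
residual, and vanishing of the residuals along a PGD sequence. -/
theorem pgd_residual_rate
    (n : ℕ) (hn : 1 ≤ n)
    (f φ : EuclideanSpace ℝ (Fin n) → ℝ) (Lf M lam τ Fstar : ℝ)
    (hf : Differentiable ℝ f)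
    (hLip : ∀ a b, ‖gradient f a - gradient f b‖ ≤ Lf * ‖a - b‖)
    (hM : 0 < M)
    (hφ : ConvexOn ℝ Set.univ (fun w => φ w + (M / 2) * ‖w‖ ^ 2))
    (hlam : 0 < lam) (hτ : 0 < τ) (hτlt : τ < 2 / (lam * Lf + M))
    (hFstar : ∀ w, Fstar ≤ lam * f w + φ w)
    (x : ℕ → EuclideanSpace ℝ (Fin n))
    (hx : ∀ k, IsMinOn
      (fun w => τ * φ w + (1 / 2) * ‖w - (x k - (τ * lam) • gradient f (x k))‖ ^ 2)
      Set.univ (x (k + 1))) :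
    (∀ K : ℕ, 1 ≤ K →
      ∑ k ∈ Finset.range K, ‖x (k + 1) - x k‖ ^ 2 ≤
        (lam * f (x 0) + φ (x 0) - Fstar) / (1 / τ - (M + lam * Lf) / 2)) ∧
    (∀ K : ℕ, (hK : 1 ≤ K) →
      (Finset.range K).inf'
          (Finset.nonempty_range_iff.mpr (Nat.one_le_iff_ne_zero.mp hK))
          (fun k => ‖x (k + 1) - x k‖ ^ 2) ≤
        (lam * f (x 0) + φ (x 0) - Fstar) / (K * (1 / τ - (M + lam * Lf) / 2))) ∧
    Tendsto (fun k : ℕ => ‖x (k + 1) - x k‖) atTop (nhds 0) := by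
  have hL : 0 ≤ Lf := by
    have : Nonempty (Fin n) := ⟨⟨0, hn⟩⟩
    obtain ⟨v, hv⟩ := exists_ne (0 : EuclideanSpace ℝ (Fin n))
    have h := (norm_nonneg _).trans (hLip v 0)
    rw [sub_zero] at h
    exact nonneg_of_mul_nonneg_left h (norm_pos_iff.2 hv)
  have hc : 0 < 1 / τ - (M + lam * Lf) / 2 := by
    have hpos : 0 < lam * Lf + M := by positivity
    rw [lt_div_iff₀ hpos] at hτlt
    rw [sub_pos, lt_div_iff₀ hτ]
    linarith
  set c := 1 / τ - (M + lam * Lf) / 2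
  have hsum : ∀ K : ℕ, ∑ k ∈ Finset.range K, ‖x (k + 1) - x k‖ ^ 2 ≤
      (lam * f (x 0) + φ (x 0) - Fstar) / c := by
    intro K
    rw [le_div_iff₀' hc, Finset.mul_sum]
    refine (Finset.sum_le_sum fun k _ =>
      proximal_gradient_step_decrease hf hLip hφ hlam.le hτ (hx k)).trans ?_
    rw [Finset.sum_range_sub' (fun k => lam * f (x k) + φ (x k))]
    linarith [hFstar (x K)]
  refine ⟨fun K _ => hsum K, fun K hK => ?_, ?_⟩
  · have hK0 : (0 : ℝ) < K := by exact_mod_cast hK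
    rw [mul_comm (K : ℝ), ← div_div, le_div_iff₀' hK0]
    refine le_trans ?_ (hsum K)
    have h := Finset.card_nsmul_le_sum (Finset.range K) (fun k => ‖x (k + 1) - x k‖ ^ 2)
      ((Finset.range K).inf' (Finset.nonempty_range_iff.mpr (Nat.one_le_iff_ne_zero.mp hK))
        (fun k => ‖x (k + 1) - x k‖ ^ 2))
      fun k hk => Finset.inf'_le (fun k => ‖x (k + 1) - x k‖ ^ 2) hk
    rwa [Finset.card_range, nsmul_eq_mul] at h
  · have hsq := (summable_of_sum_range_le (fun k => sq_nonneg ‖x (k + 1) - x k‖)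
      hsum).tendsto_atTop_zero
    simpa using hsq.sqrt
end

section
/- Let n ≥ 1, let f : ℝⁿ → ℝ be differentiable with L_f-Lipschitz gradient and bounded below, let M > 0 and let φ : ℝⁿ → ℝ be M-weakly convex and bounded below. Let λ > 0 and τ > 0 satisfy τ < 2/(λ·L_f + M), and let (x_k) be a PGD sequence for f, φ, λ, τ. Then every cluster point y of the sequence (x_k) is a stationary point of F := λ·f + φ, in the following sense: for all x ∈ ℝⁿ, φ(x) + (M/2)‖x‖² ≥ φ(y) + (M/2)‖y‖² + ⟨M·y − λ·∇f(y), x − y⟩ (i.e. M·y − λ·∇f(y) is a subgradient at y of the convex function φ + (M/2)‖·‖², equivalently −λ·∇f(y) ∈ ∂φ(y)). -/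
open Filter Topology
open scoped RealInnerProductSpace

/-- **Descent lemma** for functions with Lipschitz gradient. -/
lemma le_add_inner_gradient_add_of_lipschitz_gradient
    {E : Type*} [NormedAddCommGroup E] [InnerProductSpace ℝ E] [CompleteSpace E]
    {f : E → ℝ} {L : ℝ} (hf : Differentiable ℝ f)
    (hLip : ∀ a b, ‖gradient f a - gradient f b‖ ≤ L * ‖a - b‖) (a b : E) :
    f b ≤ f a + ⟪gradient f a, b - a⟫ + L / 2 * ‖b - a‖ ^ 2 := by
  set d := b - a with hd
  have hderiv (t : ℝ) : HasDerivAt (fun t : ℝ => f (a + t • d))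
      ⟪gradient f (a + t • d), d⟫ t := by
    have hline : HasDerivAt (fun t : ℝ => a + t • d) d t := by
      simpa using ((hasDerivAt_id t).smul_const d).const_add a
    simpa [Function.comp_def] using (hf (a + t • d)).hasGradientAt.hasFDerivAt.comp_hasDerivAt t hline
  have hbound (t : ℝ) : HasDerivAt
      (fun t : ℝ => f a + t * ⟪gradient f a, d⟫ + L / 2 * ‖d‖ ^ 2 * t ^ 2)
      (⟪gradient f a, d⟫ + L * ‖d‖ ^ 2 * t) t := by
    refine ((((hasDerivAt_id t).mul_const ⟪gradient f a, d⟫).const_add (f a)).add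
      (((hasDerivAt_id t).pow 2).const_mul (L / 2 * ‖d‖ ^ 2))).congr_deriv ?_
    simp only [id_eq]
    push_cast
    ring
  have hle := image_le_of_deriv_right_le_deriv_boundary (a := (0 : ℝ)) (b := 1)
    (fun t _ => (hderiv t).continuousAt.continuousWithinAt)
    (fun t _ => (hderiv t).hasDerivWithinAt) (by simp)
    (fun t _ => (hbound t).continuousAt.continuousWithinAt)
    (fun t _ => (hbound t).hasDerivWithinAt) (fun t ht => by
      have h1 := real_inner_le_norm (gradient f (a + t • d) - gradient f a) d
      have h2 := hLip (a + t • d) a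
      rw [add_sub_cancel_left, norm_smul, Real.norm_of_nonneg ht.1] at h2
      rw [inner_sub_left] at h1
      nlinarith [mul_le_mul_of_nonneg_right h2 (norm_nonneg d)])
    (Set.right_mem_Icc.mpr zero_le_one)
  simpa [hd] using hle

/-- A subgradient up to a quadratic error is a subgradient of a convex function. -/
lemma ConvexOn.add_inner_le_of_sub_sq_le
    {E : Type*} [NormedAddCommGroup E] [InnerProductSpace ℝ E]
    {ψ : E → ℝ} (hψ : ConvexOn ℝ Set.univ ψ) {p v : E} {K : ℝ}
    (h : ∀ w, ψ p + ⟪v, w - p⟫ - K * ‖w - p‖ ^ 2 ≤ ψ w) (u : E) :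
    ψ p + ⟪v, u - p⟫ ≤ ψ u := by
  have hlim : Tendsto (fun t : ℝ => ψ p + ⟪v, u - p⟫ - K * ‖u - p‖ ^ 2 * t) (𝓝[>] 0)
      (𝓝 (ψ p + ⟪v, u - p⟫)) := by
    have hcont : Continuous (fun t : ℝ => ψ p + ⟪v, u - p⟫ - K * ‖u - p‖ ^ 2 * t) := by
      fun_prop
    simpa using (hcont.tendsto 0).mono_left nhdsWithin_le_nhds
  refine le_of_tendsto hlim ?_
  filter_upwards [Ioo_mem_nhdsGT (zero_lt_one' ℝ)] with t ht
  have hconv := hψ.2 (Set.mem_univ p) (Set.mem_univ u) (sub_nonneg.mpr ht.2.le) ht.1.le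
    (sub_add_cancel 1 t)
  have hpt := h ((1 - t) • p + t • u)
  have hdiff : (1 - t) • p + t • u - p = t • (u - p) := by module
  rw [hdiff, inner_smul_right, norm_smul, Real.norm_of_nonneg ht.1.le] at hpt
  simp only [smul_eq_mul] at hconv
  refine le_of_mul_le_mul_left ?_ ht.1
  nlinarith

/-- First-order optimality condition for the proximal step of a weakly convex function. -/
lemma add_inner_le_of_isMinOn_prox
    {E : Type*} [NormedAddCommGroup E] [InnerProductSpace ℝ E]
    {φ : E → ℝ} {M τ : ℝ} (hφ : ConvexOn ℝ Set.univ (fun w => φ w + (M / 2) * ‖w‖ ^ 2))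
    (hτ : 0 < τ) {p z : E}
    (hp : IsMinOn (fun w => τ * φ w + (1 / 2) * ‖w - z‖ ^ 2) Set.univ p) (u : E) :
    φ p + (M / 2) * ‖p‖ ^ 2 + ⟪M • p - τ⁻¹ • (p - z), u - p⟫ ≤ φ u + (M / 2) * ‖u‖ ^ 2 := by
  refine hφ.add_inner_le_of_sub_sq_le (K := (τ⁻¹ - M) / 2) (fun w => ?_) u
  have hmin : τ * φ p + (1 / 2) * ‖p - z‖ ^ 2 ≤ τ * φ w + (1 / 2) * ‖w - z‖ ^ 2 :=
    hp (Set.mem_univ w)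
  have hz : ‖w - z‖ ^ 2 = ‖w - p‖ ^ 2 + 2 * ⟪p - z, w - p⟫ + ‖p - z‖ ^ 2 := by
    rw [← sub_add_sub_cancel w p z, norm_add_sq_real, real_inner_comm]
  have hw : ‖w‖ ^ 2 = ‖w - p‖ ^ 2 + 2 * ⟪p, w - p⟫ + ‖p‖ ^ 2 := by
    conv_lhs => rw [← sub_add_cancel w p]
    rw [norm_add_sq_real, real_inner_comm]
  have hdiv : φ p ≤ φ w + τ⁻¹ * (1 / 2 * ‖w - p‖ ^ 2 + ⟪p - z, w - p⟫) := by
    refine le_of_mul_le_mul_left ?_ hτ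
    rw [mul_add, mul_inv_cancel_left₀ hτ.ne']
    linarith
  simp only [inner_sub_left (M • p), real_inner_smul_left, hw]
  linarith

/-- The increments of a sequence tend to zero if their squares are controlled by the decrease
of a function bounded below. -/
lemma tendsto_sub_of_sufficient_decrease
    {E : Type*} [NormedAddCommGroup E] {F : E → ℝ} (hF : BddBelow (Set.range F))
    {c : ℝ} (hc : 0 < c) {x : ℕ → E}
    (hx : ∀ k, F (x (k + 1)) + c * ‖x (k + 1) - x k‖ ^ 2 ≤ F (x k)) :
    Tendsto (fun k => x (k + 1) - x k) atTop (𝓝 0) := by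
  have hanti : Antitone (fun k => F (x k)) := antitone_nat_of_succ_le fun k => by
    nlinarith [hx k, sq_nonneg ‖x (k + 1) - x k‖]
  have hlim := tendsto_atTop_ciInf hanti
    (hF.mono (Set.range_comp_subset_range x F))
  have hdiff : Tendsto (fun k => (F (x k) - F (x (k + 1))) / c) atTop (𝓝 0) := by
    simpa using (hlim.sub (hlim.comp (tendsto_add_atTop_nat 1))).div_const c
  have hsq : Tendsto (fun k => ‖x (k + 1) - x k‖ ^ 2) atTop (𝓝 0) :=
    squeeze_zero (fun _ => sq_nonneg _)
      (fun k => by rw [le_div_iff₀ hc]; linarith [hx k]) hdiff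
  refine tendsto_zero_iff_norm_tendsto_zero.mpr ?_
  simpa using hsq.sqrt

/-- Every cluster point of a PGD sequence is a stationary point of
`F = λ f + φ`, in the sense that `-λ ∇f(y) ∈ ∂φ(y)`, i.e. `M y - λ ∇f(y)`
is a subgradient at `y` of the convex function `φ + (M/2)‖·‖²`. -/
theorem pgd_cluster_points_stationary
    (n : ℕ) (hn : 1 ≤ n)
    (f φ : EuclideanSpace ℝ (Fin n) → ℝ) (Lf M lam τ : ℝ)
    (hf : Differentiable ℝ f)
    (hLip : ∀ a b, ‖gradient f a - gradient f b‖ ≤ Lf * ‖a - b‖)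
    (hfb : BddBelow (Set.range f))
    (hM : 0 < M)
    (hφ : ConvexOn ℝ Set.univ (fun w => φ w + (M / 2) * ‖w‖ ^ 2))
    (hφb : BddBelow (Set.range φ))
    (hlam : 0 < lam) (hτ : 0 < τ) (hτlt : τ < 2 / (lam * Lf + M))
    (x : ℕ → EuclideanSpace ℝ (Fin n))
    (hx : ∀ k, IsMinOn
      (fun w => τ * φ w + (1 / 2) * ‖w - (x k - (τ * lam) • gradient f (x k))‖ ^ 2)
      Set.univ (x (k + 1)))
    (y : EuclideanSpace ℝ (Fin n))
    (hy : ∃ k : ℕ → ℕ, Tendsto k atTop atTop ∧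
      Tendsto (fun i => x (k i)) atTop (nhds y)) :
    ∀ u : EuclideanSpace ℝ (Fin n),
      φ u + (M / 2) * ‖u‖ ^ 2 ≥
        φ y + (M / 2) * ‖y‖ ^ 2 + ⟪M • y - lam • gradient f y, u - y⟫ := by
  intro u
  obtain ⟨k, hk, hky⟩ := hy
  have hLf : 0 ≤ Lf := by
    have : Nonempty (Fin n) := ⟨⟨0, hn⟩⟩
    obtain ⟨a, ha⟩ := exists_ne (0 : EuclideanSpace ℝ (Fin n))
    have h := (norm_nonneg _).trans (hLip a 0)
    rw [sub_zero] at h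
    exact nonneg_of_mul_nonneg_left h (norm_pos_iff.mpr ha)
  have hc : 0 < τ⁻¹ - (lam * Lf + M) / 2 := by
    have hpos : 0 < lam * Lf + M := by positivity
    rw [lt_div_iff₀ hpos] at hτlt
    have h : (lam * Lf + M) / 2 < τ⁻¹ := by
      rw [← one_div, lt_div_iff₀ hτ]
      linarith
    linarith
  have hopt (j : ℕ) (w : EuclideanSpace ℝ (Fin n)) :
      φ (x (j + 1)) + (M / 2) * ‖x (j + 1)‖ ^ 2 +
        ⟪M • x (j + 1) - τ⁻¹ • (x (j + 1) - x j) - lam • gradient f (x j), w - x (j + 1)⟫ ≤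
      φ w + (M / 2) * ‖w‖ ^ 2 := by
    convert add_inner_le_of_isMinOn_prox hφ hτ (hx j) w using 3
    rw [← sub_add, smul_add, smul_smul, inv_mul_cancel_left₀ hτ.ne', sub_add_eq_sub_sub]
  have hdecr (j : ℕ) : (lam * f (x (j + 1)) + φ (x (j + 1))) +
      (τ⁻¹ - (lam * Lf + M) / 2) * ‖x (j + 1) - x j‖ ^ 2 ≤ lam * f (x j) + φ (x j) := by
    have hprox := hopt j (x j)
    have hdesc := mul_le_mul_of_nonneg_left
      (le_add_inner_gradient_add_of_lipschitz_gradient hf hLip (x j) (x (j + 1))) hlam.le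
    have hsq : ‖x j‖ ^ 2 = ‖x (j + 1) - x j‖ ^ 2 - 2 * ⟪x (j + 1), x (j + 1) - x j⟫ +
        ‖x (j + 1)‖ ^ 2 := by
      conv_lhs => rw [← sub_sub_cancel (x (j + 1)) (x j)]
      rw [norm_sub_sq_real]
      ring
    rw [← neg_sub (x (j + 1)) (x j), inner_neg_right, inner_sub_left, inner_sub_left,
      real_inner_smul_left, real_inner_smul_left, real_inner_smul_left,
      real_inner_self_eq_norm_sq, hsq] at hprox
    linarith
  have hbdd : BddBelow (Set.range (fun w => lam * f w + φ w)) := by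
    obtain ⟨A, hA⟩ := hfb
    obtain ⟨B, hB⟩ := hφb
    refine ⟨lam * A + B, ?_⟩
    rintro _ ⟨w, rfl⟩
    exact add_le_add (mul_le_mul_of_nonneg_left (hA ⟨w, rfl⟩) hlam.le) (hB ⟨w, rfl⟩)
  have hincr : Tendsto (fun i => x (k i + 1) - x (k i)) atTop (𝓝 0) :=
    (tendsto_sub_of_sufficient_decrease hbdd hc hdecr).comp hk
  have hnext : Tendsto (fun i => x (k i + 1)) atTop (𝓝 y) := by
    simpa using hincr.add hky
  have hgrad : Continuous (gradient f) :=
    (LipschitzWith.of_dist_le_mul (K := ⟨Lf, hLf⟩) fun a b => by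
      rw [dist_eq_norm, dist_eq_norm]
      exact hLip a b).continuous
  have hψ : Continuous (fun w => φ w + (M / 2) * ‖w‖ ^ 2) :=
    continuousOn_univ.mp (hφ.continuousOn isOpen_univ)
  have hlim := ((hψ.tendsto y).comp hnext).add
    ((((hnext.const_smul M).sub (hincr.const_smul τ⁻¹)).sub
      (((hgrad.tendsto y).comp hky).const_smul lam)).inner (𝕜 := ℝ)
      ((tendsto_const_nhds (x := u)).sub hnext))
  rw [smul_zero, sub_zero] at hlim
  exact le_of_tendsto hlim (Eventually.of_forall fun i => hopt (k i) u)
end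

section
/- Let n ≥ 1, let f : ℝⁿ → ℝ be convex and differentiable with L_f-Lipschitz gradient, let M > 0 and let φ : ℝⁿ → ℝ be M-weakly convex. Let λ > 0, α ∈ (0,1), and τ > 0 with τ·α·λ·L_f ≤ 1. Let (q_k), (x_k), (y_k) be αPGD sequences for f, φ, λ, τ, α, set F := λ·f + φ, and define the refined constants δ' := ((1−α)/(2·α·τ))·(1 − α²·τ·λ·L_f) and γ' := (1/(2·α·τ))·(1 + α − α²·τ·λ·L_f − τ·M·(2−α)). Then for every k ≥ 1, F(y_k) − F(y_{k+1}) ≥ −δ'·‖y_k − y_{k−1}‖² + γ'·‖y_{k+1} − y_k‖²; moreover γ' − δ' > 0 if and only if τ < 2α/(α³·λ·L_f + (2−α)·M). -/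
open InnerProductSpace in
/-- First-order lower bound of a differentiable convex function. -/
theorem ConvexOn.add_inner_gradient_le {E : Type*} [NormedAddCommGroup E]
    [InnerProductSpace ℝ E] [CompleteSpace E] {f : E → ℝ}
    (hfc : ConvexOn ℝ Set.univ f) {a : E} (hf : DifferentiableAt ℝ f a) (b : E) :
    f a + inner ℝ (gradient f a) (b - a) ≤ f b := by
  have hline : HasDerivAt (fun t : ℝ => AffineMap.lineMap a b t) (b - a) 0 :=
    AffineMap.hasDerivAt_lineMap
  have hd : HasDerivAt (fun t : ℝ => f (AffineMap.lineMap a b t))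
      (inner ℝ (gradient f a) (b - a)) 0 := by
    have hfa : HasFDerivAt f (toDual ℝ E (gradient f a))
        (AffineMap.lineMap a b (0 : ℝ)) := by
      simpa using hf.hasGradientAt.hasFDerivAt
    exact hfa.comp_hasDerivAt 0 hline
  have hconv : ConvexOn ℝ Set.univ (fun t : ℝ => f (AffineMap.lineMap a b t)) :=
    hfc.comp_affineMap (AffineMap.lineMap a b)
  have := hconv.le_slope_of_hasDerivAt (Set.mem_univ 0) (Set.mem_univ 1) zero_lt_one hd
  simp only [slope_def_field, AffineMap.lineMap_apply_one, AffineMap.lineMap_apply_zero, sub_zero,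
    div_one] at this
  linarith

open InnerProductSpace in
/-- The descent lemma for functions with Lipschitz gradient. -/
theorem le_add_inner_gradient_add_sq_of_lipschitz {E : Type*} [NormedAddCommGroup E]
    [InnerProductSpace ℝ E] [CompleteSpace E] {f : E → ℝ} {L : ℝ}
    (hf : Differentiable ℝ f)
    (hLip : ∀ a b, ‖gradient f a - gradient f b‖ ≤ L * ‖a - b‖) (a b : E) :
    f b ≤ f a + inner ℝ (gradient f a) (b - a) + L / 2 * ‖b - a‖ ^ 2 := by
  set v := b - a with hv
  have hline (t : ℝ) : HasDerivAt (fun t : ℝ => AffineMap.lineMap a b t) v t :=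
    AffineMap.hasDerivAt_lineMap
  have hd (t : ℝ) : HasDerivAt (fun t : ℝ => f (AffineMap.lineMap a b t)
        - (t * inner ℝ (gradient f a) v + L / 2 * ‖v‖ ^ 2 * t ^ 2))
      (inner ℝ (gradient f (AffineMap.lineMap a b t)) v
        - (inner ℝ (gradient f a) v + L * ‖v‖ ^ 2 * t)) t := by
    have h₁ := ((hf (AffineMap.lineMap a b t)).hasGradientAt.hasFDerivAt).comp_hasDerivAt t
      (hline t)
    have h₂ := ((hasDerivAt_id t).mul_const (inner ℝ (gradient f a) v)).add
      ((hasDerivAt_pow 2 t).const_mul (L / 2 * ‖v‖ ^ 2))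
    refine (h₁.sub h₂).congr_deriv ?_
    simp
    ring
  have hanti : AntitoneOn (fun t : ℝ => f (AffineMap.lineMap a b t)
      - (t * inner ℝ (gradient f a) v + L / 2 * ‖v‖ ^ 2 * t ^ 2)) (Set.Icc 0 1) := by
    refine antitoneOn_of_hasDerivWithinAt_nonpos (convex_Icc 0 1)
      (fun t _ => (hd t).continuousAt.continuousWithinAt)
      (fun t _ => (hd t).hasDerivWithinAt) fun t ht => ?_
    rw [interior_Icc] at ht
    have hnorm : ‖AffineMap.lineMap a b t - a‖ = t * ‖v‖ := by
      rw [AffineMap.lineMap_apply_module', add_sub_cancel_right, norm_smul,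
        Real.norm_of_nonneg ht.1.le]
    have hinner := (real_inner_le_norm (gradient f (AffineMap.lineMap a b t) - gradient f a) v).trans
      (mul_le_mul_of_nonneg_right (hLip _ _) (norm_nonneg v))
    rw [inner_sub_left, hnorm] at hinner
    linarith
  have := hanti (Set.left_mem_Icc.2 zero_le_one) (Set.right_mem_Icc.2 zero_le_one) zero_le_one
  simp only [AffineMap.lineMap_apply_one, AffineMap.lineMap_apply_zero] at this
  linarith

/-- The segment inequality for a weakly convex function. -/
theorem weaklyConvex_le {E : Type*} [NormedAddCommGroup E] [InnerProductSpace ℝ E]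
    {φ : E → ℝ} {M : ℝ}
    (hφ : ConvexOn ℝ Set.univ (fun w => φ w + (M / 2) * ‖w‖ ^ 2)) (a b : E) {t : ℝ}
    (ht₀ : 0 ≤ t) (ht₁ : t ≤ 1) :
    φ ((1 - t) • a + t • b) ≤
      (1 - t) * φ a + t * φ b + M / 2 * (t * (1 - t)) * ‖b - a‖ ^ 2 := by
  have h := hφ.2 (Set.mem_univ a) (Set.mem_univ b) (sub_nonneg.2 ht₁) ht₀ (by ring)
  have hn : ‖(1 - t) • a + t • b‖ ^ 2 =
      (1 - t) * ‖a‖ ^ 2 + t * ‖b‖ ^ 2 - t * (1 - t) * ‖b - a‖ ^ 2 := by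
    rw [norm_add_sq_real, norm_sub_sq_real, norm_smul, norm_smul, mul_pow, mul_pow,
      real_inner_smul_left, real_inner_smul_right, real_inner_comm b a]
    simp only [Real.norm_eq_abs, sq_abs]
    ring
  simp only [smul_eq_mul, hn] at h
  linarith

/-- The variational inequality for a proximal point of a weakly convex function. -/
theorem weaklyConvex_prox_le {E : Type*} [NormedAddCommGroup E] [InnerProductSpace ℝ E]
    {φ : E → ℝ} {M τ : ℝ}
    (hφ : ConvexOn ℝ Set.univ (fun w => φ w + (M / 2) * ‖w‖ ^ 2)) (hτ : 0 < τ) {p z : E}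
    (hp : IsMinOn (fun w => τ * φ w + (1 / 2) * ‖w - z‖ ^ 2) Set.univ p) (w : E) :
    τ * φ p ≤ τ * φ w + inner ℝ (p - z) (w - p) + τ * (M / 2) * ‖w - p‖ ^ 2 := by
  have key : ∀ t ∈ Set.Ioo (0 : ℝ) 1, τ * φ p ≤ τ * φ w + inner ℝ (p - z) (w - p)
      + τ * (M / 2) * (1 - t) * ‖w - p‖ ^ 2 + t / 2 * ‖w - p‖ ^ 2 := by
    rintro t ⟨ht₀, ht₁⟩
    have hmin := isMinOn_iff.1 hp ((1 - t) • p + t • w) (Set.mem_univ _)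
    have hconv := mul_le_mul_of_nonneg_left (weaklyConvex_le hφ p w ht₀.le ht₁.le) hτ.le
    have hn : ‖(1 - t) • p + t • w - z‖ ^ 2 =
        ‖p - z‖ ^ 2 + 2 * (t * inner ℝ (p - z) (w - p)) + t ^ 2 * ‖w - p‖ ^ 2 := by
      rw [show (1 - t) • p + t • w - z = (p - z) + t • (w - p) by module, norm_add_sq_real,
        real_inner_smul_right, norm_smul, mul_pow, Real.norm_eq_abs, sq_abs]
    rw [hn] at hmin
    refine le_of_mul_le_mul_left ?_ ht₀
    linarith
  have hcont : Continuous fun t : ℝ => τ * φ w + inner ℝ (p - z) (w - p)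
      + τ * (M / 2) * (1 - t) * ‖w - p‖ ^ 2 + t / 2 * ‖w - p‖ ^ 2 := by fun_prop
  have hlim := (hcont.tendsto 0).mono_left (nhdsWithin_le_nhds (s := Set.Ioi 0))
  have := ge_of_tendsto hlim (Filter.eventually_of_mem (Ioo_mem_nhdsGT zero_lt_one) key)
  simpa using this

/-- Refined per-iteration descent inequality for the αPGD algorithm, with
constants `δ' = ((1-α)/(2ατ))(1 - α²τλL_f)` and
`γ' = (1/(2ατ))(1 + α - α²τλL_f - τM(2-α))`, together with the
characterization `γ' - δ' > 0 ↔ τ < 2α/(α³λL_f + (2-α)M)`. -/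
theorem alphaPGD_refined_descent_inequality
    (n : ℕ) (hn : 1 ≤ n)
    (f φ : EuclideanSpace ℝ (Fin n) → ℝ) (Lf M lam α τ : ℝ)
    (hfc : ConvexOn ℝ Set.univ f)
    (hf : Differentiable ℝ f)
    (hLip : ∀ a b, ‖gradient f a - gradient f b‖ ≤ Lf * ‖a - b‖)
    (hM : 0 < M)
    (hφ : ConvexOn ℝ Set.univ (fun w => φ w + (M / 2) * ‖w‖ ^ 2))
    (hlam : 0 < lam) (hα0 : 0 < α) (hα1 : α < 1)
    (hτ : 0 < τ) (hτle : τ * α * lam * Lf ≤ 1)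
    (q x y : ℕ → EuclideanSpace ℝ (Fin n))
    (hy0 : y 0 = x 0)
    (hq : ∀ k, q (k + 1) = (1 - α) • y k + α • x k)
    (hx : ∀ k, IsMinOn
      (fun w => τ * φ w + (1 / 2) * ‖w - (x k - (τ * lam) • gradient f (q (k + 1)))‖ ^ 2)
      Set.univ (x (k + 1)))
    (hy : ∀ k, y (k + 1) = (1 - α) • y k + α • x (k + 1)) :
    (∀ k : ℕ, 1 ≤ k →
      (lam * f (y k) + φ (y k)) - (lam * f (y (k + 1)) + φ (y (k + 1))) ≥
        -(((1 - α) / (2 * α * τ)) * (1 - α ^ 2 * τ * lam * Lf)) * ‖y k - y (k - 1)‖ ^ 2 +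
          (1 / (2 * α * τ)) * (1 + α - α ^ 2 * τ * lam * Lf - τ * M * (2 - α)) *
            ‖y (k + 1) - y k‖ ^ 2) ∧
    ((1 / (2 * α * τ)) * (1 + α - α ^ 2 * τ * lam * Lf - τ * M * (2 - α)) -
        ((1 - α) / (2 * α * τ)) * (1 - α ^ 2 * τ * lam * Lf) > 0 ↔
      τ < 2 * α / (α ^ 3 * lam * Lf + (2 - α) * M)) := by
  have hC : 0 < 1 / (2 * α * τ) := by positivity
  constructor
  · rintro (_ | k) hk
    · omega
    simp only [Nat.add_sub_cancel]
    set g := gradient f (q (k + 1 + 1))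
    set d := y (k + 1 + 1) - y (k + 1) with hd
    set p := y (k + 1) - y k with hp
    have hdx : x (k + 1 + 1) - y (k + 1) = α⁻¹ • d := by
      rw [hd, hy (k + 1), eq_inv_smul_iff₀ hα0.ne']
      module
    have hpx : x (k + 1) - y (k + 1) = ((1 - α) * α⁻¹) • p := by
      rw [mul_smul, hp]
      have : α⁻¹ • (y (k + 1) - y k) = x (k + 1) - y k := by
        rw [inv_smul_eq_iff₀ hα0.ne', hy k]
        module
      rw [this, hy k]
      module
    have hqy : q (k + 1 + 1) - y (k + 1) = (1 - α) • p := by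
      have : q (k + 1 + 1) - y (k + 1) = α • (x (k + 1) - y (k + 1)) := by
        rw [hq (k + 1)]
        module
      rw [this, hpx, smul_smul]
      congr 1
      field_simp
    have hyq : y (k + 1 + 1) - q (k + 1 + 1) = d - (1 - α) • p := by
      rw [← hqy, hd]
      abel
    have hyq' : y (k + 1) - q (k + 1 + 1) = -((1 - α) • p) := by
      rw [← hqy, neg_sub]
    have hlow := hfc.add_inner_gradient_le (hf (q (k + 1 + 1))) (y (k + 1))
    have hup := le_add_inner_gradient_add_sq_of_lipschitz hf hLip (q (k + 1 + 1)) (y (k + 1 + 1))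
    have hprox := weaklyConvex_prox_le hφ hτ (hx (k + 1)) (y (k + 1))
    have hseg := weaklyConvex_le hφ (y (k + 1)) (x (k + 1 + 1)) hα0.le hα1.le
    rw [← hy (k + 1), hdx] at hseg
    have hprox₁ : x (k + 1 + 1) - (x (k + 1) - (τ * lam) • g) =
        α⁻¹ • (d - (1 - α) • p) + (τ * lam) • g := by
      rw [smul_sub, smul_smul, mul_comm α⁻¹, ← hdx, ← hpx]
      abel
    have hprox₂ : y (k + 1) - x (k + 1 + 1) = -(α⁻¹ • d) := by
      rw [← hdx, neg_sub]
    rw [hprox₁, hprox₂] at hprox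
    rw [hyq'] at hlow
    rw [hyq] at hup
    have hsq : ‖d - (1 - α) • p‖ ^ 2 =
        ‖d‖ ^ 2 - 2 * (1 - α) * inner ℝ d p + (1 - α) ^ 2 * ‖p‖ ^ 2 := by
      rw [norm_sub_sq_real, real_inner_smul_right, norm_smul, mul_pow, Real.norm_eq_abs, sq_abs]
      ring
    have hdp : ‖d - p‖ ^ 2 = ‖d‖ ^ 2 - 2 * inner ℝ d p + ‖p‖ ^ 2 := norm_sub_sq_real d p
    have hd' : ‖α⁻¹ • d‖ ^ 2 = α⁻¹ ^ 2 * ‖d‖ ^ 2 := by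
      rw [norm_smul, mul_pow, Real.norm_eq_abs, sq_abs]
    rw [hsq, inner_sub_right, real_inner_smul_right] at hup
    rw [inner_neg_right, real_inner_smul_right] at hlow
    rw [norm_neg, hd', inner_neg_right, real_inner_smul_right, inner_add_left,
      real_inner_smul_left, real_inner_smul_left, inner_sub_left, real_inner_smul_left,
      real_inner_self_eq_norm_sq, real_inner_comm d p] at hprox
    rw [hd'] at hseg
    have hf_step := mul_le_mul_of_nonneg_left (add_le_add hup hlow) hlam.le
    have hprox_step := mul_le_mul_of_nonneg_left hprox (div_pos hα0 hτ).le
    have hrem : 0 ≤ (1 / (2 * α * τ)) * (1 - τ * α * lam * Lf) * (1 - α) * ‖d - p‖ ^ 2 :=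
      mul_nonneg (mul_nonneg (mul_nonneg hC.le (by linarith)) (by linarith)) (sq_nonneg _)
    rw [hdp] at hrem
    generalize ‖d‖ ^ 2 = D at *
    generalize ‖p‖ ^ 2 = P at *
    generalize (inner ℝ d p : ℝ) = I at *
    have hsum := add_le_add (add_le_add hf_step hprox_step) (add_le_add hseg hrem)
    rw [ge_iff_le, ← sub_nonneg]
    refine (sub_nonneg.2 hsum).trans_eq ?_
    field_simp
    ring
  · have hn : (0 : ℝ) ≤ Lf := by
      have : Nonempty (Fin n) := ⟨⟨0, hn⟩⟩
      obtain ⟨a, b, hab⟩ := exists_pair_ne (EuclideanSpace ℝ (Fin n))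
      exact nonneg_of_mul_nonneg_left ((norm_nonneg _).trans (hLip a b))
        (norm_pos_iff.2 (sub_ne_zero.2 hab))
    have hden : 0 < α ^ 3 * lam * Lf + (2 - α) * M :=
      add_pos_of_nonneg_of_pos (by positivity) (mul_pos (by linarith) hM)
    have hdiff : (1 / (2 * α * τ)) * (1 + α - α ^ 2 * τ * lam * Lf - τ * M * (2 - α)) -
        ((1 - α) / (2 * α * τ)) * (1 - α ^ 2 * τ * lam * Lf) =
        (1 / (2 * α * τ)) * (2 * α - τ * (α ^ 3 * lam * Lf + (2 - α) * M)) := by ring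
    rw [hdiff, gt_iff_lt, mul_pos_iff_of_pos_left hC, sub_pos, lt_div_iff₀ hden]
end

section
/- Let n ≥ 1 and let g : ℝⁿ → ℝ be twice continuously differentiable with gradient ∇g Lipschitz with constant L < 1. Define D : ℝⁿ → ℝⁿ by D(x) = x − ∇g(x) and set M := L/(L+1). Then there exists a function φ : ℝⁿ → EReal (the extended reals ℝ ∪ {−∞, +∞}), nowhere equal to −∞, such that: (a) φ is M-weakly convex in the extended sense, i.e. the function ψ(w) := φ(w) + (M/2)‖w‖² satisfies ψ(t·x + (1−t)·y) ≤ t·ψ(x) + (1−t)·ψ(y) for all x, y ∈ ℝⁿ and t ∈ [0,1] (with multiplication of nonnegative reals and addition in EReal); and (b) for every x ∈ ℝⁿ, D(x) is the unique global minimizer over ℝⁿ of w ↦ φ(w) + ((1/2)‖w − x‖² : EReal), and φ(D(x)) is finite. -/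
/-- A perturbation of the identity by a strict contraction is bijective. -/
theorem bijective_id_sub_of_lipschitz {E : Type*} [NormedAddCommGroup E] [CompleteSpace E]
    {F : E → E} {L : ℝ} (hL0 : 0 ≤ L) (hL1 : L < 1)
    (hLip : ∀ a b, ‖F a - F b‖ ≤ L * ‖a - b‖) :
    Function.Bijective fun x => x - F x := by
  constructor
  · intro x y hxy
    have h1 : x - y = F x - F y := by
      rw [sub_eq_sub_iff_sub_eq_sub] at hxy
      exact hxy
    have h2 := hLip x y
    rw [← h1] at h2
    have h3 : ‖x - y‖ = 0 := by nlinarith [norm_nonneg (x - y)]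
    exact sub_eq_zero.1 (norm_eq_zero.1 h3)
  · intro w
    have hc : ContractingWith ⟨L, hL0⟩ (fun z => w + F z) := by
      refine ⟨by exact_mod_cast hL1, LipschitzWith.of_dist_le_mul fun x y => ?_⟩
      rw [dist_add_left, dist_eq_norm, dist_eq_norm]
      exact hLip x y
    refine ⟨hc.fixedPoint, ?_⟩
    have h : w + F hc.fixedPoint = hc.fixedPoint := hc.fixedPoint_isFixedPt
    exact sub_eq_of_eq_add h.symm

section GradientStep

variable {E : Type*} [NormedAddCommGroup E] [InnerProductSpace ℝ E]

/-- Descent lemma: a function with `L`-Lipschitz gradient lies below its quadratic upper model. -/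
theorem le_quadratic_of_lipschitz_gradient [CompleteSpace E] {f : E → ℝ} {f' : E → E} {L : ℝ}
    (hf : ∀ x, HasGradientAt f (f' x) x) (hLip : ∀ a b, ‖f' a - f' b‖ ≤ L * ‖a - b‖) (a b : E) :
    f b ≤ f a + inner ℝ (f' a) (b - a) + L / 2 * ‖b - a‖ ^ 2 := by
  set v := b - a with hv
  let k : ℝ → ℝ := fun t => f (a + t • v) - t * inner ℝ (f' a) v - L / 2 * ‖v‖ ^ 2 * t ^ 2
  have hk : ∀ t, HasDerivAt k
      (inner ℝ (f' (a + t • v)) v - inner ℝ (f' a) v - L * ‖v‖ ^ 2 * t) t := by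
    intro t
    have h1 : HasDerivAt (fun t : ℝ => a + t • v) v t := by
      simpa using ((hasDerivAt_id t).smul_const v).const_add a
    have h2 := (hf (a + t • v)).hasFDerivAt.comp_hasDerivAt t h1
    have h3 := (hasDerivAt_id t).mul_const (inner ℝ (f' a) v)
    have h4 := (hasDerivAt_pow 2 t).const_mul (L / 2 * ‖v‖ ^ 2)
    refine ((h2.sub h3).sub h4).congr_deriv ?_
    rw [InnerProductSpace.toDual_apply_apply]
    norm_num
    ring
  have hanti : AntitoneOn k (Set.Icc 0 1) := by
    refine antitoneOn_of_deriv_nonpos (convex_Icc 0 1)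
      (fun t _ => (hk t).continuousAt.continuousWithinAt)
      (fun t _ => (hk t).differentiableAt.differentiableWithinAt) fun t ht => ?_
    rw [interior_Icc] at ht
    rw [(hk t).deriv, ← inner_sub_left]
    have h1 := real_inner_le_norm (f' (a + t • v) - f' a) v
    have h2 := hLip (a + t • v) a
    rw [add_sub_cancel_left, norm_smul, Real.norm_of_nonneg ht.1.le] at h2
    nlinarith [mul_le_mul_of_nonneg_right h2 (norm_nonneg v)]
  have h := hanti (Set.left_mem_Icc.2 zero_le_one) (Set.right_mem_Icc.2 zero_le_one) zero_le_one
  simp only [k, hv, one_smul, zero_smul, add_sub_cancel, add_zero] at h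
  linarith

/-- A real function with a subgradient at every point is convex. -/
theorem convexOn_univ_of_forall_exists_subgradient {ψ : E → ℝ}
    (h : ∀ u, ∃ s : E, ∀ v, ψ u + inner ℝ s (v - u) ≤ ψ v) : ConvexOn ℝ Set.univ ψ := by
  refine ⟨convex_univ, fun x _ y _ a b ha hb hab => ?_⟩
  obtain ⟨s, hs⟩ := h (a • x + b • y)
  have hx := mul_le_mul_of_nonneg_left (hs x) ha
  have hy := mul_le_mul_of_nonneg_left (hs y) hb
  simp only [inner_sub_right, inner_add_right, inner_smul_right] at hx hy
  obtain rfl : b = 1 - a := by linarith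
  simp only [smul_eq_mul]
  linarith

/-- Cocoercivity of the gradient `x - g' x` of the convex function `‖x‖² / 2 - g x`, written in
terms of `g`. -/
theorem cocoercive_of_quadratic_bounds {g : E → ℝ} {g' : E → E} {L : ℝ} (hL0 : 0 ≤ L)
    (hL1 : L < 1)
    (hup : ∀ a b, g b ≤ g a + inner ℝ (g' a) (b - a) + L / 2 * ‖b - a‖ ^ 2)
    (hlo : ∀ a b, g a + inner ℝ (g' a) (b - a) - L / 2 * ‖b - a‖ ^ 2 ≤ g b) (x z : E) :
    1 / (2 * (L + 1)) * ‖(x - g' x) - (z - g' z)‖ ^ 2 ≤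
      (1 / 2 * ‖x‖ ^ 2 - g x) - (1 / 2 * ‖z‖ ^ 2 - g z) - inner ℝ (z - g' z) (x - z) := by
  have hL : L + 1 ≠ 0 := by positivity
  obtain ⟨c, hc⟩ : ∃ c, c = 1 / (L + 1) := ⟨_, rfl⟩
  have hc1 : c * (L + 1) = 1 := by rw [hc]; field_simp
  set d := (x - g' x) - (z - g' z) with hd
  obtain ⟨y, hy⟩ : ∃ y, y = x - c • d := ⟨_, rfl⟩
  have h1 := hlo x y
  have h2 : g y ≤ g z + inner ℝ (g' z) (y - z) + 1 / 2 * ‖y - z‖ ^ 2 := by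
    nlinarith [hup z y, sq_nonneg ‖y - z‖]
  have hyx : y - x = -(c • d) := by rw [hy]; abel
  have hyz : y - z = (x - z) - c • d := by rw [hy]; abel
  have hdd : inner ℝ (g' x) d - inner ℝ (g' z) d = inner ℝ (x - z) d - ‖d‖ ^ 2 := by
    rw [← inner_sub_left, ← real_inner_self_eq_norm_sq, ← inner_sub_left]
    congr 1
    rw [hd]; abel
  have hxz : ‖x - z‖ ^ 2 = ‖x‖ ^ 2 - 2 * inner ℝ z x + ‖z‖ ^ 2 := by
    rw [norm_sub_sq_real, real_inner_comm]
  rw [hyx, inner_neg_right, inner_smul_right, norm_neg, norm_smul, mul_pow, Real.norm_eq_abs,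
    sq_abs] at h1
  rw [hyz, inner_sub_right, inner_smul_right, norm_sub_sq_real, inner_smul_right, norm_smul,
    mul_pow, Real.norm_eq_abs, sq_abs] at h2
  have hcc : 1 / (2 * (L + 1)) = c / 2 := by rw [hc]; field_simp
  have hquad : (c ^ 2 * (L + 1)) * ‖d‖ ^ 2 = c * ‖d‖ ^ 2 := by
    rw [pow_two, mul_assoc c, hc1, mul_one]
  have hdd' := congrArg (c * ·) hdd
  simp only [mul_sub] at hdd'
  rw [hcc, inner_sub_left, inner_sub_right z, real_inner_self_eq_norm_sq]
  linarith

end GradientStep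

/-- Characterization of the gradient-step denoiser `D = Id - ∇g` as the
proximal operator of an `M`-weakly convex potential `φ : ℝⁿ → EReal`, with
`M = L/(L+1)`, when `∇g` is `L`-Lipschitz with `L < 1`. -/
theorem gradient_step_denoiser_is_prox
    (n : ℕ) (hn : 1 ≤ n)
    (g : EuclideanSpace ℝ (Fin n) → ℝ) (L : ℝ)
    (hg : ContDiff ℝ 2 g)
    (hL1 : L < 1)
    (hLip : ∀ a b, ‖gradient g a - gradient g b‖ ≤ L * ‖a - b‖) :
    ∃ φ : EuclideanSpace ℝ (Fin n) → EReal,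
      (∀ w, φ w ≠ ⊥) ∧
      (∀ x y : EuclideanSpace ℝ (Fin n), ∀ t : ℝ, 0 ≤ t → t ≤ 1 →
        φ (t • x + (1 - t) • y) +
            ((L / (L + 1) / 2 * ‖t • x + (1 - t) • y‖ ^ 2 : ℝ) : EReal) ≤
          ((t : ℝ) : EReal) * (φ x + ((L / (L + 1) / 2 * ‖x‖ ^ 2 : ℝ) : EReal)) +
            ((1 - t : ℝ) : EReal) * (φ y + ((L / (L + 1) / 2 * ‖y‖ ^ 2 : ℝ) : EReal))) ∧
      (∀ x : EuclideanSpace ℝ (Fin n),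
        (∀ w, φ (x - gradient g x) +
              ((1 / 2 * ‖(x - gradient g x) - x‖ ^ 2 : ℝ) : EReal) ≤
            φ w + ((1 / 2 * ‖w - x‖ ^ 2 : ℝ) : EReal)) ∧
        (∀ w, φ w + ((1 / 2 * ‖w - x‖ ^ 2 : ℝ) : EReal) =
              φ (x - gradient g x) +
                ((1 / 2 * ‖(x - gradient g x) - x‖ ^ 2 : ℝ) : EReal) →
            w = x - gradient g x) ∧
        φ (x - gradient g x) ≠ ⊤) := by
  have hL0 : 0 ≤ L := by
    have : Nonempty (Fin n) := ⟨⟨0, hn⟩⟩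
    obtain ⟨a, ha⟩ := exists_ne (0 : EuclideanSpace ℝ (Fin n))
    have h := (norm_nonneg _).trans (hLip a 0)
    rw [sub_zero] at h
    exact nonneg_of_mul_nonneg_left h (norm_pos_iff.2 ha)
  have hgrad : ∀ x, HasGradientAt g (gradient g x) x := fun x =>
    (hg.differentiable (by norm_num) x).hasGradientAt
  have hup := le_quadratic_of_lipschitz_gradient hgrad hLip
  have hlo : ∀ a b, g a + inner ℝ (gradient g a) (b - a) - L / 2 * ‖b - a‖ ^ 2 ≤ g b := by
    intro a b
    have h := le_quadratic_of_lipschitz_gradient (f := -g) (f' := fun x => -gradient g x) (L := L)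
      (fun x => by
        rw [hasGradientAt_iff_hasFDerivAt, map_neg]
        exact (hgrad x).hasFDerivAt.neg)
      (fun a b => by
        rw [neg_sub_neg, norm_sub_rev]
        exact hLip a b) a b
    simp only [Pi.neg_apply, inner_neg_left] at h
    linarith
  obtain ⟨hinj, hsurj⟩ := bijective_id_sub_of_lipschitz hL0 hL1 hLip
  choose p hp using hsurj
  have hpD : ∀ x, p (x - gradient g x) = x := fun x => hinj (hp _)
  simp only at hp
  let φ : EuclideanSpace ℝ (Fin n) → ℝ := fun w => g (p w) - 1 / 2 * ‖w - p w‖ ^ 2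
  have hgap : ∀ x w, φ (x - gradient g x) + 1 / 2 * ‖(x - gradient g x) - x‖ ^ 2 +
      (1 - L) / 2 * ‖x - p w‖ ^ 2 ≤ φ w + 1 / 2 * ‖w - x‖ ^ 2 := by
    intro x w
    have h := hup (p w) x
    have hw : w - x = (w - p w) - (x - p w) := by abel
    have hgw : gradient g (p w) = -(w - p w) := by
      conv_rhs => rw [← hp w, hpD]
      abel
    rw [hgw, inner_neg_left] at h
    simp only [φ, hpD]
    rw [hw, norm_sub_sq_real (w - p w)]
    linarith
  have hconv : ConvexOn ℝ Set.univ fun w => φ w + L / (L + 1) / 2 * ‖w‖ ^ 2 := by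
    refine convexOn_univ_of_forall_exists_subgradient fun u =>
      ⟨p u - (1 / (L + 1)) • u, fun v => ?_⟩
    have h := cocoercive_of_quadratic_bounds hL0 hL1 hup hlo (p u) (p v)
    rw [hp, hp] at h
    have hL : L + 1 ≠ 0 := by positivity
    obtain ⟨c, hc⟩ : ∃ c, c = 1 / (L + 1) := ⟨_, rfl⟩
    have h1 : 1 / (2 * (L + 1)) = c / 2 := by rw [hc]; field_simp
    have h2 : L / (L + 1) = 1 - c := by rw [hc]; field_simp; ring
    rw [h1, norm_sub_sq_real, inner_sub_right] at h
    rw [← hc, h2]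
    simp only [φ]
    rw [norm_sub_sq_real, norm_sub_sq_real, inner_sub_left, inner_smul_left, inner_sub_right,
      inner_sub_right, real_inner_self_eq_norm_sq, real_inner_comm v (p u),
      real_inner_comm u (p u)]
    simp only [conj_trivial]
    linarith
  refine ⟨fun w => (φ w : EReal), fun w => EReal.coe_ne_bot _, fun x y t ht0 ht1 => ?_,
    fun x => ⟨fun w => ?_, fun w hw => ?_, EReal.coe_ne_top _⟩⟩
  · have h := hconv.2 (Set.mem_univ x) (Set.mem_univ y) ht0 (sub_nonneg.2 ht1)
      (add_sub_cancel t 1)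
    simp only [smul_eq_mul] at h
    beta_reduce
    exact_mod_cast h
  · have h := hgap x w
    have h' : 0 ≤ (1 - L) / 2 * ‖x - p w‖ ^ 2 :=
      mul_nonneg (by linarith) (sq_nonneg _)
    have h'' : φ (x - gradient g x) + 1 / 2 * ‖(x - gradient g x) - x‖ ^ 2 ≤
      φ w + 1 / 2 * ‖w - x‖ ^ 2 := by linarith
    beta_reduce
    exact_mod_cast h''
  · beta_reduce at hw
    have h := hgap x w
    have hw' : φ w + 1 / 2 * ‖w - x‖ ^ 2 =
        φ (x - gradient g x) + 1 / 2 * ‖(x - gradient g x) - x‖ ^ 2 := by exact_mod_cast hw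
    have h0 : ‖x - p w‖ ^ 2 = 0 := by nlinarith [sq_nonneg ‖x - p w‖]
    have hx : x = p w := sub_eq_zero.1 (norm_eq_zero.1 (pow_eq_zero_iff two_ne_zero |>.1 h0))
    rw [hx, hp]
end

section
/- (Three-points inequality.) Let n ≥ 1, M > 0, and let φ : ℝⁿ → ℝ be M-weakly convex. Let z ∈ ℝⁿ and let z⁺ be a global minimizer over ℝⁿ of w ↦ φ(w) + (1/2)‖w − z‖². Then for all x ∈ ℝⁿ, φ(x) + (1/2)‖x − z‖² ≥ φ(z⁺) + (1/2)‖z⁺ − z‖² + ((1 − M)/2)‖x − z⁺‖². -/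
/-- A minimizer of a strongly convex function satisfies the quadratic growth inequality. The modulus
may have any sign. -/
theorem StrongConvexOn.add_sq_norm_sub_le_of_isMinOn {E : Type*} [NormedAddCommGroup E]
    [NormedSpace ℝ E] {s : Set E} {m : ℝ} {f : E → ℝ} (hf : StrongConvexOn s m f) {a x : E}
    (hmin : IsMinOn f s a) (ha : a ∈ s) (hx : x ∈ s) :
    f a + m / 2 * ‖x - a‖ ^ 2 ≤ f x := by
  have hle : ∀ t ∈ Set.Ioo (0 : ℝ) 1, f a + (1 - t) * (m / 2 * ‖x - a‖ ^ 2) ≤ f x := by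
    rintro t ⟨ht0, ht1⟩
    have hconv := hf.2 hx ha ht0.le (sub_nonneg.2 ht1.le) (add_sub_cancel t 1)
    have hge := isMinOn_iff.1 hmin _
      (hf.1 hx ha ht0.le (sub_nonneg.2 ht1.le) (add_sub_cancel t 1))
    simp only [smul_eq_mul] at hconv
    refine le_of_mul_le_mul_left ?_ ht0
    linarith
  have hlim : Filter.Tendsto (fun t : ℝ => f a + (1 - t) * (m / 2 * ‖x - a‖ ^ 2))
      (nhdsWithin 0 (Set.Ioi 0)) (nhds (f a + m / 2 * ‖x - a‖ ^ 2)) := by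
    have hcont : Continuous (fun t : ℝ => f a + (1 - t) * (m / 2 * ‖x - a‖ ^ 2)) := by fun_prop
    simpa using (hcont.tendsto 0).mono_left nhdsWithin_le_nhds
  exact le_of_tendsto hlim
    (Filter.mem_of_superset (Ioo_mem_nhdsGT one_pos) hle)

/-- Adding half the squared distance to a point to an `M`-weakly convex function yields a strongly
convex function of modulus `1 - M`. -/
theorem strongConvexOn_add_half_sq_norm_sub {E : Type*} [NormedAddCommGroup E]
    [InnerProductSpace ℝ E] {s : Set E} {M : ℝ} {φ : E → ℝ}
    (hφ : ConvexOn ℝ s (fun w => φ w + (M / 2) * ‖w‖ ^ 2)) (z : E) :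
    StrongConvexOn s (1 - M) (fun w => φ w + (1 / 2) * ‖w - z‖ ^ 2) := by
  rw [strongConvexOn_iff_convex]
  have hlin : ConvexOn ℝ s (fun w => -inner ℝ z w + (1 / 2) * ‖z‖ ^ 2) :=
    ((-(innerₛₗ ℝ z)).convexOn hφ.1).add_const _
  refine (hφ.add hlin).congr fun w _ => ?_
  simp only [Pi.add_apply, norm_sub_sq_real, real_inner_comm w z]
  ring


/-- Three-points inequality for the proximal operator of an `M`-weakly
convex function. -/
theorem three_points_inequality
    (n : ℕ) (hn : 1 ≤ n) (M : ℝ) (hM : 0 < M)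
    (φ : EuclideanSpace ℝ (Fin n) → ℝ)
    (hφ : ConvexOn ℝ Set.univ (fun w => φ w + (M / 2) * ‖w‖ ^ 2))
    (z zp : EuclideanSpace ℝ (Fin n))
    (hzp : IsMinOn (fun w => φ w + (1 / 2) * ‖w - z‖ ^ 2) Set.univ zp) :
    ∀ x : EuclideanSpace ℝ (Fin n),
      φ x + (1 / 2) * ‖x - z‖ ^ 2 ≥
        φ zp + (1 / 2) * ‖zp - z‖ ^ 2 + ((1 - M) / 2) * ‖x - zp‖ ^ 2 := by
  exact fun x => (strongConvexOn_add_half_sq_norm_sub hφ z).add_sq_norm_sub_le_of_isMinOn hzp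
    (Set.mem_univ zp) (Set.mem_univ x)
end

section
/- Let n ≥ 1, M > 0, let φ : ℝⁿ → ℝ be M-weakly convex, and let α ∈ (0,1]. Let x, y ∈ ℝⁿ and set y⁺ := (1−α)·y + α·x. Then φ(x) ≥ (1/α)·φ(y⁺) + (1 − 1/α)·φ(y) − (M/2)·(1−α)·‖y − x‖². -/
theorem norm_sq_convex_combination {E : Type*} [NormedAddCommGroup E] [InnerProductSpace ℝ E]
    (a : ℝ) (x y : E) :
    ‖(1 - a) • y + a • x‖ ^ 2 =
      (1 - a) * ‖y‖ ^ 2 + a * ‖x‖ ^ 2 - a * (1 - a) * ‖y - x‖ ^ 2 := by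
  rw [norm_add_sq_real, norm_sub_sq_real, norm_smul, norm_smul, mul_pow, mul_pow,
    inner_smul_left, inner_smul_right, Real.norm_eq_abs, Real.norm_eq_abs, sq_abs, sq_abs]
  simp only [conj_trivial]
  ring

/-- Extrapolation (reverse Jensen) inequality for an `M`-weakly convex
function: with `y⁺ = (1-α) y + α x`,
`φ(x) ≥ (1/α) φ(y⁺) + (1 - 1/α) φ(y) - (M/2)(1-α)‖y - x‖²`. -/
theorem weakly_convex_extrapolation
    (n : ℕ) (hn : 1 ≤ n) (M : ℝ) (hM : 0 < M)
    (φ : EuclideanSpace ℝ (Fin n) → ℝ)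
    (hφ : ConvexOn ℝ Set.univ (fun w => φ w + (M / 2) * ‖w‖ ^ 2))
    (α : ℝ) (hα0 : 0 < α) (hα1 : α ≤ 1)
    (x y : EuclideanSpace ℝ (Fin n)) :
    φ x ≥ (1 / α) * φ ((1 - α) • y + α • x) + (1 - 1 / α) * φ y -
      (M / 2) * (1 - α) * ‖y - x‖ ^ 2 := by
  have hconv := hφ.2 (Set.mem_univ y) (Set.mem_univ x) (sub_nonneg.2 hα1) hα0.le
    (sub_add_cancel 1 α)
  simp only [smul_eq_mul] at hconv
  rw [norm_sq_convex_combination] at hconv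
  have hα : α ≠ 0 := hα0.ne'
  have key : φ ((1 - α) • y + α • x) ≤
      α * φ x + (1 - α) * φ y + α * ((M / 2) * (1 - α) * ‖y - x‖ ^ 2) := by
    linarith
  have hdiv := mul_le_mul_of_nonneg_left key (one_div_pos.2 hα0).le
  have hexp : 1 / α * (α * φ x + (1 - α) * φ y + α * ((M / 2) * (1 - α) * ‖y - x‖ ^ 2)) =
      φ x - (1 - 1 / α) * φ y + (M / 2) * (1 - α) * ‖y - x‖ ^ 2 := by
    field_simp
    ring
  linarith
end
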